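/- arXiv:1206.1583 — 6 statements merged into one kernel-verified Lean document; each statement's English description precedes it below -/
import Mathlib

section
/- Let N ≥ 1 be an integer, p > 1, m > 0 real, α, β ∈ ℝ, and a > 0. Let g : [0,a) → ℝ be positive and continuously differentiable with g'(0) = 0. Set h(r) := g(r)^{1/m} and P(r) := |g'(r)|^{p−2} g'(r). Assume P is differentiable on (0,a) and that for every r ∈ (0,a) the self-similar ODE holds in the form α h(r) + β r h'(r) + ((N−1)/r) P(r) + P'(r) = 0. Then for every r ∈ (0,a), P(r) = −β r h(r) − ((α − βN)/r^{N−1}) ∫_0^r s^{N−1} h(s) ds. -/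
open Set

/-- First integral of the self-similar profile ODE for `u_t = Δ_p u^m`:
if `α h + β r h' + ((N−1)/r) P + P' = 0` on `(0,a)`, where `h = g^(1/m)` and
`P = |g'|^(p−2) g'`, then
`P(r) = −β r h(r) − ((α − βN)/r^(N−1)) ∫₀^r s^(N−1) h(s) ds` on `(0,a)`. -/
theorem stmt6 (N : ℕ) (hN : 1 ≤ N) (p m α β a : ℝ) (hp : 1 < p) (hm : 0 < m) (ha : 0 < a)
    (g g' : ℝ → ℝ)
    (hpos : ∀ r ∈ Ico (0:ℝ) a, 0 < g r)
    (hderiv : ∀ r ∈ Ico (0:ℝ) a, HasDerivAt g (g' r) r)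
    (hg'cont : ContinuousOn g' (Ico 0 a))
    (hg'0 : g' 0 = 0)
    (P' : ℝ → ℝ)
    (hP : ∀ r ∈ Ioo (0:ℝ) a,
      HasDerivAt (fun s => |g' s| ^ (p - 2) * g' s) (P' r) r)
    (hODE : ∀ r ∈ Ioo (0:ℝ) a,
      α * g r ^ (1/m) + β * r * deriv (fun s => g s ^ (1/m)) r +
        ((N - 1 : ℝ) / r) * (|g' r| ^ (p - 2) * g' r) + P' r = 0) :
    ∀ r ∈ Ioo (0:ℝ) a,
      |g' r| ^ (p - 2) * g' r =
        -β * r * g r ^ (1/m) - ((α - β * N) / r ^ ((N : ℝ) - 1)) *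
          ∫ s in (0:ℝ)..r, s ^ ((N : ℝ) - 1) * g s ^ (1/m) := by
  intro R hR
  obtain ⟨k, rfl⟩ : ∃ k, N = k + 1 := ⟨N - 1, by omega⟩
  have hk : (((k + 1 : ℕ) : ℝ) - 1) = (k : ℝ) := by push_cast; ring
  simp only [hk, Real.rpow_natCast] at hODE ⊢
  set P : ℝ → ℝ := fun s => |g' s| ^ (p - 2) * g' s with hPdef
  set h : ℝ → ℝ := fun s => g s ^ (1/m) with hhdef
  have hhd : ∀ r ∈ Ico (0:ℝ) a, HasDerivAt h (deriv h r) r := by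
    intro r hr
    exact ((hderiv r hr).differentiableAt.rpow_const (Or.inl (hpos r hr).ne')).hasDerivAt
  have hhc : ∀ r ∈ Ico (0:ℝ) a, ContinuousAt (fun s => s ^ k * h s) r := by
    intro r hr
    exact (continuous_pow k).continuousAt.mul (hhd r hr).continuousAt
  have hPabs : ∀ s, |P s| = |g' s| ^ (p - 1) := by
    intro s
    simp only [hPdef]
    rcases eq_or_ne (g' s) 0 with h0 | h0
    · rw [h0]; simp [Real.zero_rpow (by linarith : p - 1 ≠ 0)]
    · rw [abs_mul, abs_of_nonneg (Real.rpow_nonneg (abs_nonneg _) _),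
        ← Real.rpow_add_one (abs_pos.mpr h0).ne']
      congr 1; ring
  have hP0 : P 0 = 0 := by simp [hPdef, hg'0]
  have hPc : ContinuousOn P (Icc 0 R) := by
    intro r hr
    rcases hr.1.eq_or_lt with h0 | h0
    · subst h0
      have h1 : ContinuousWithinAt (fun s => |g' s| ^ (p - 1)) (Icc 0 R) 0 := by
        have h2 : ContinuousWithinAt g' (Icc 0 R) 0 :=
          (hg'cont 0 ⟨le_rfl, ha⟩).mono (fun x hx => ⟨hx.1, hx.2.trans_lt hR.2⟩)
        exact h2.abs.rpow_const (Or.inr (by linarith))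
      have h3 : Filter.Tendsto (fun s => |g' s| ^ (p - 1)) (nhdsWithin 0 (Icc 0 R)) (nhds 0) := by
        have := h1.tendsto
        simpa [hg'0, Real.zero_rpow (by linarith : p - 1 ≠ 0)] using this
      unfold ContinuousWithinAt
      rw [hP0]
      exact squeeze_zero_norm (fun s => (hPabs s).le) h3
    · exact (hP r ⟨h0, hr.2.trans_lt hR.2⟩).continuousAt.continuousWithinAt
  have hint : ∀ r ∈ Ico (0:ℝ) a, IntervalIntegrable (fun s => s ^ k * h s)
      MeasureTheory.volume 0 r := by
    intro r hr
    apply ContinuousOn.intervalIntegrable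
    intro x hx
    rw [uIcc_of_le hr.1] at hx
    exact (hhc x ⟨hx.1, hx.2.trans_lt hr.2⟩).continuousWithinAt
  have hId : ∀ r ∈ Ioo (0:ℝ) a,
      HasDerivAt (fun u => ∫ s in (0:ℝ)..u, s ^ k * h s) (r ^ k * h r) r := by
    intro r hr
    apply intervalIntegral.integral_hasDerivAt_right (hint r ⟨hr.1.le, hr.2⟩)
    · exact ContinuousOn.stronglyMeasurableAtFilter isOpen_Ioo
        (fun x hx => (hhc x ⟨hx.1.le, hx.2⟩).continuousWithinAt) r hr
    · exact hhc r ⟨hr.1.le, hr.2⟩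
  have hIc : ContinuousOn (fun u => ∫ s in (0:ℝ)..u, s ^ k * h s) (Icc 0 R) := by
    have h1 := intervalIntegral.continuousOn_primitive_interval'
      (hint R ⟨hR.1.le, hR.2⟩) left_mem_uIcc
    rwa [uIcc_of_le hR.1.le] at h1
  obtain ⟨c, hc, hslope⟩ := exists_hasDerivAt_eq_slope
    (fun r => r ^ k * P r + β * (r ^ (k+1) * h r)
      + (α - β * ((k + 1 : ℕ) : ℝ)) * ∫ s in (0:ℝ)..r, s ^ k * h s)
    (fun _ => 0) hR.1
    (by
      have hhc' : ContinuousOn h (Icc 0 R) := fun x hx =>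
        (hhd x ⟨hx.1, hx.2.trans_lt hR.2⟩).continuousAt.continuousWithinAt
      exact (((continuous_pow k).continuousOn.mul hPc).add
        (continuousOn_const.mul ((continuous_pow (k+1)).continuousOn.mul hhc'))).add
        (continuousOn_const.mul hIc))
    (by
      intro r hr
      have hr' : r ∈ Ioo (0:ℝ) a := ⟨hr.1, hr.2.trans hR.2⟩
      have hd := (((hasDerivAt_pow k r).mul (hP r hr')).add
        (((hasDerivAt_pow (k+1) r).mul (hhd r ⟨hr'.1.le, hr'.2⟩)).const_mul β)).add
        ((hId r hr').const_mul (α - β * ((k + 1 : ℕ) : ℝ)))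
      refine hd.congr_deriv ?_
      have hO := hODE r hr'
      have hr0 : r ≠ 0 := hr.1.ne'
      have hkk : (k : ℝ) * r ^ (k - 1) = r ^ k * (k / r) := by
        rcases k with _ | j
        · simp
        · simp only [Nat.add_sub_cancel]; field_simp; ring
      change (k : ℝ) * r ^ (k - 1) * P r + r ^ k * P' r + _ + _ = 0
      change α * h r + β * r * deriv h r + k / r * P r + P' r = 0 at hO
      rw [hkk]
      simp only [Nat.add_sub_cancel]
      push_cast
      linear_combination r ^ k * hO)
  have hRk : R ^ k ≠ 0 := pow_ne_zero _ hR.1.ne'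
  have hfin := hslope.symm
  rw [div_eq_zero_iff] at hfin
  rcases hfin with hfin | hfin
  · simp only [hP0, intervalIntegral.integral_same] at hfin
    change P R = -β * R * h R - (α - β * ((k + 1 : ℕ) : ℝ)) / R ^ k * ∫ s in (0:ℝ)..R, s ^ k * h s
    generalize (∫ s in (0:ℝ)..R, s ^ k * h s) = I at hfin ⊢
    generalize α - β * ((k + 1 : ℕ) : ℝ) = C at hfin ⊢
    have hz : R ^ k * P R + β * (R ^ (k+1) * h R) + C * I = 0 := by
      simpa using hfin
    apply mul_left_cancel₀ hRk
    have : R ^ k * (C / R ^ k * I) = C * I := by field_simp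
    rw [mul_sub, this]
    linear_combination hz
  · exact absurd hfin (by linarith [hR.1])
end

section
/- Let p > 1 and m > 0 be real numbers with m(p−1) > 1, let β > 0, M > 0, a > 0. Let g : [0,a) → ℝ be continuous on [0,a) and differentiable on (0,a), with g > 0 on [0,a), g(0) = M^m, and suppose that for every r ∈ (0,a), g'(r) ≤ −β^{1/(p−1)} r^{1/(p−1)} g(r)^{1/(m(p−1))}. Then for every r ∈ [0,a), g(r)^{(m(p−1)−1)/(m(p−1))} ≤ M^{(m(p−1)−1)/(p−1)} − ((m(p−1)−1)/(mp)) β^{1/(p−1)} r^{p/(p−1)}; equivalently, g(r) ≤ (M^{(m(p−1)−1)/(p−1)} − ((m(p−1)−1)/(mp)) β^{1/(p−1)} r^{p/(p−1)})^{m(p−1)/(m(p−1)−1)} and the quantity in parentheses is positive. -/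
open Set

/-- In the degenerate range `m(p−1) > 1`, the differential inequality
`g'(r) ≤ −β^(1/(p−1)) r^(1/(p−1)) g(r)^(1/(m(p−1)))` together with `g(0) = M^m`
yields the pointwise upper bound
`g(r)^((m(p−1)−1)/(m(p−1))) ≤ M^((m(p−1)−1)/(p−1)) − ((m(p−1)−1)/(mp)) β^(1/(p−1)) r^(p/(p−1))`,
the positivity of the right-hand side, and the equivalent bound on `g(r)`. -/
theorem stmt8 (p m β M a : ℝ) (hp : 1 < p) (hm : 0 < m) (hmp : 1 < m * (p - 1))
    (hβ : 0 < β) (hM : 0 < M) (ha : 0 < a)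
    (g g' : ℝ → ℝ)
    (hcont : ContinuousOn g (Ico 0 a))
    (hderiv : ∀ r ∈ Ioo (0:ℝ) a, HasDerivAt g (g' r) r)
    (hpos : ∀ r ∈ Ico (0:ℝ) a, 0 < g r)
    (hg0 : g 0 = M ^ m)
    (hineq : ∀ r ∈ Ioo (0:ℝ) a,
      g' r ≤ -(β ^ (1/(p-1))) * r ^ (1/(p-1)) * g r ^ (1/(m*(p-1)))) :
    ∀ r ∈ Ico (0:ℝ) a,
      g r ^ ((m*(p-1) - 1)/(m*(p-1))) ≤
        M ^ ((m*(p-1) - 1)/(p-1)) - ((m*(p-1) - 1)/(m*p)) * β ^ (1/(p-1)) * r ^ (p/(p-1)) ∧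
      0 < M ^ ((m*(p-1) - 1)/(p-1)) - ((m*(p-1) - 1)/(m*p)) * β ^ (1/(p-1)) * r ^ (p/(p-1)) ∧
      g r ≤ (M ^ ((m*(p-1) - 1)/(p-1)) -
          ((m*(p-1) - 1)/(m*p)) * β ^ (1/(p-1)) * r ^ (p/(p-1))) ^ (m*(p-1)/(m*(p-1) - 1)) := by
  have hp1 : 0 < p - 1 := by linarith
  have hk : 0 < m * (p - 1) := by linarith
  have hk1 : 0 < m * (p - 1) - 1 := by linarith
  have hp0 : 0 < p := by linarith
  have hθ : 0 < (m*(p-1) - 1)/(m*(p-1)) := div_pos hk1 hk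
  have hq : 0 < p/(p-1) := div_pos hp0 hp1
  have hD : ∀ x ∈ Ioo (0:ℝ) a, HasDerivAt
      (fun r => g r ^ ((m*(p-1) - 1)/(m*(p-1))) +
        ((m*(p-1) - 1)/(m*p)) * β ^ (1/(p-1)) * r ^ (p/(p-1)))
      (g' x * ((m*(p-1) - 1)/(m*(p-1))) * g x ^ ((m*(p-1) - 1)/(m*(p-1)) - 1) +
        ((m*(p-1) - 1)/(m*p)) * β ^ (1/(p-1)) * (p/(p-1) * x ^ (p/(p-1) - 1))) x := by
    intro x hx
    have hgx := hpos x ⟨hx.1.le, hx.2⟩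
    exact ((hderiv x hx).rpow_const (Or.inl hgx.ne')).add
      ((Real.hasDerivAt_rpow_const (Or.inl hx.1.ne')).const_mul _)
  have hanti : AntitoneOn (fun r => g r ^ ((m*(p-1) - 1)/(m*(p-1))) +
        ((m*(p-1) - 1)/(m*p)) * β ^ (1/(p-1)) * r ^ (p/(p-1))) (Ico 0 a) := by
    apply antitoneOn_of_deriv_nonpos (convex_Ico 0 a)
    · apply ContinuousOn.add
      · exact hcont.rpow_const (fun x _ => Or.inr hθ.le)
      · exact continuousOn_const.mul
          (continuousOn_id.rpow_const (fun x _ => Or.inr hq.le))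
    · rw [interior_Ico]
      exact fun x hx => (hD x hx).differentiableAt.differentiableWithinAt
    · rw [interior_Ico]
      intro x hx
      rw [(hD x hx).deriv]
      have hgx := hpos x ⟨hx.1.le, hx.2⟩
      have e1 : (m*(p-1) - 1)/(m*(p-1)) - 1 = -(1/(m*(p-1))) := by
        field_simp
        ring
      have e2 : p/(p-1) - 1 = 1/(p-1) := by
        field_simp
        ring
      have e3 : ((m*(p-1) - 1)/(m*p)) * (p/(p-1)) = (m*(p-1) - 1)/(m*(p-1)) := by
        field_simp
      rw [e1, e2]
      have hG : 0 < g x ^ (-(1/(m*(p-1)))) := Real.rpow_pos_of_pos hgx _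
      have hGG : g x ^ (1/(m*(p-1))) * g x ^ (-(1/(m*(p-1)))) = 1 := by
        rw [← Real.rpow_add hgx, add_neg_cancel, Real.rpow_zero]
      have h := mul_le_mul_of_nonneg_right (hineq x hx) (mul_pos hθ hG).le
      have h2 : ((m*(p-1) - 1)/(m*p)) * β ^ (1/(p-1)) * (p/(p-1) * x ^ (1/(p-1)))
          = (m*(p-1) - 1)/(m*(p-1)) * β ^ (1/(p-1)) * x ^ (1/(p-1)) := by
        rw [← e3]
        ring
      have h3 : -(β ^ (1/(p-1))) * x ^ (1/(p-1)) * g x ^ (1/(m*(p-1))) *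
          ((m*(p-1) - 1)/(m*(p-1)) * g x ^ (-(1/(m*(p-1))))) =
          -((m*(p-1) - 1)/(m*(p-1)) * β ^ (1/(p-1)) * x ^ (1/(p-1))) := by
        calc _ = -((m*(p-1) - 1)/(m*(p-1)) * β ^ (1/(p-1)) * x ^ (1/(p-1))) *
              (g x ^ (1/(m*(p-1))) * g x ^ (-(1/(m*(p-1))))) := by ring
          _ = _ := by rw [hGG, mul_one]
      rw [h2]
      rw [h3, ← mul_assoc] at h
      linarith
  intro r hr
  have hgr := hpos r hr
  have h := hanti ⟨le_refl 0, ha⟩ hr hr.1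
  have e4 : m * ((m*(p-1) - 1)/(m*(p-1))) = (m*(p-1) - 1)/(p-1) := by
    field_simp
  simp only [hg0, Real.zero_rpow hq.ne', mul_zero, add_zero] at h
  rw [← Real.rpow_mul hM.le, e4] at h
  have h1 := le_sub_iff_add_le.mpr h
  have hgp : 0 < g r ^ ((m*(p-1) - 1)/(m*(p-1))) := Real.rpow_pos_of_pos hgr _
  refine ⟨h1, hgp.trans_le h1, ?_⟩
  have h5 := Real.rpow_le_rpow hgp.le h1 (div_pos hk hk1).le
  rw [← Real.rpow_mul hgr.le, div_mul_div_cancel₀ hk.ne', div_self hk1.ne',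
    Real.rpow_one] at h5
  exact h5
end

section
/- Let p > 1 and m > 0 be real numbers with m(p−1) > 1, let β > 0, M > 0, a > 0. Let g : [0,a) → ℝ be continuous on [0,a) and differentiable on (0,a), with g > 0 on [0,a), g(0) = M^m, and suppose that for every r ∈ (0,a), g'(r) ≤ −β^{1/(p−1)} r^{1/(p−1)} g(r)^{1/(m(p−1))}. Then a ≤ M^{(m(p−1)−1)/p} (mp/(m(p−1)−1))^{(p−1)/p} β^{−1/p}. -/
open Set

/-- In the degenerate range `m(p−1) > 1`, the differential inequality
`g'(r) ≤ −β^(1/(p−1)) r^(1/(p−1)) g(r)^(1/(m(p−1)))` with `g > 0` on `[0,a)` and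
`g(0) = M^m` bounds the endpoint of the positivity interval:
`a ≤ M^((m(p−1)−1)/p) (mp/(m(p−1)−1))^((p−1)/p) β^(−1/p)`. -/
theorem stmt9 (p m β M a : ℝ) (hp : 1 < p) (hm : 0 < m) (hmp : 1 < m * (p - 1))
    (hβ : 0 < β) (hM : 0 < M) (ha : 0 < a)
    (g g' : ℝ → ℝ)
    (hcont : ContinuousOn g (Ico 0 a))
    (hderiv : ∀ r ∈ Ioo (0:ℝ) a, HasDerivAt g (g' r) r)
    (hpos : ∀ r ∈ Ico (0:ℝ) a, 0 < g r)
    (hg0 : g 0 = M ^ m)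
    (hineq : ∀ r ∈ Ioo (0:ℝ) a,
      g' r ≤ -(β ^ (1/(p-1))) * r ^ (1/(p-1)) * g r ^ (1/(m*(p-1)))) :
    a ≤ M ^ ((m*(p-1) - 1)/p) * (m*p/(m*(p-1) - 1)) ^ ((p-1)/p) * β ^ (-(1/p)) := by
  have hp1 : 0 < p - 1 := by linarith
  have hp0 : 0 < p := by linarith
  have hk : 0 < m * (p - 1) - 1 := by linarith
  have hmp0 : 0 < m * (p - 1) := by linarith
  obtain ⟨s, hs⟩ : ∃ s, s = 1 / (m * (p - 1)) := ⟨_, rfl⟩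
  obtain ⟨t, ht⟩ : ∃ t, t = 1 / (p - 1) := ⟨_, rfl⟩
  rw [← hs, ← ht] at hineq
  have hs1 : 0 < 1 - s := by
    rw [hs, sub_pos, div_lt_one hmp0]; exact hmp
  have ht0 : 0 < t := by rw [ht]; positivity
  have hB : 0 < β ^ t := by positivity
  set B := β ^ t with hBdef
  -- the monotone quantity
  have hanti : AntitoneOn (fun r => g r ^ (1 - s) / (1 - s) + B * (r ^ (t + 1) / (t + 1)))
      (Ico 0 a) := by
    apply antitoneOn_of_hasDerivWithinAt_nonpos (convex_Ico 0 a)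
      (f' := fun r => g' r * g r ^ (-s) + B * r ^ t)
    · apply ContinuousOn.add
      · exact (hcont.rpow_const (fun x hx => Or.inl (hpos x hx).ne')).div_const _
      · apply ContinuousOn.mul continuousOn_const
        apply ContinuousOn.div_const
        exact continuousOn_id.rpow_const (fun x _ => Or.inr (by linarith))
    · intro x hx
      rw [interior_Ico] at hx
      have hgx := hpos x ⟨hx.1.le, hx.2⟩
      have h1 := ((hderiv x hx).rpow_const (p := 1 - s) (Or.inl hgx.ne')).div_const (1 - s)
      have h2 := (((hasDerivAt_id x).rpow_const (p := t + 1)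
        (Or.inl hx.1.ne')).div_const (t + 1)).const_mul B
      have h3 := (h1.add h2).hasDerivWithinAt (s := interior (Ico 0 a))
      refine HasDerivWithinAt.congr_deriv h3 ?_
      have e1 : 1 - s - 1 = -s := by ring
      have e2 : t + 1 - 1 = t := by ring
      rw [e1, e2]
      simp only [id]
      field_simp
    · intro x hx
      rw [interior_Ico] at hx
      have hgx := hpos x ⟨hx.1.le, hx.2⟩
      have h := mul_le_mul_of_nonneg_right (hineq x hx) (Real.rpow_nonneg hgx.le (-s))
      have e : g x ^ s * g x ^ (-s) = 1 := by
        rw [← Real.rpow_add hgx]; simp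
      have e' : -B * x ^ t * g x ^ s * g x ^ (-s) = -(B * x ^ t) := by
        rw [mul_assoc (-B * x ^ t), e]; ring
      rw [e'] at h
      show g' x * g x ^ (-s) + B * x ^ t ≤ 0
      linarith
  have hc : 0 < m * p / (m * (p - 1) - 1) := by positivity
  apply le_of_forall_lt_imp_le_of_dense
  intro r hra
  rcases le_or_gt r 0 with hr | hr
  · exact hr.trans (by positivity)
  have h := hanti (show (0:ℝ) ∈ Ico 0 a from ⟨le_rfl, ha⟩) (show r ∈ Ico 0 a from ⟨hr.le, hra⟩) hr.le
  simp only at h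
  rw [Real.zero_rpow (by linarith), hg0, ← Real.rpow_mul hM.le] at h
  have hg : 0 < g r ^ (1 - s) / (1 - s) := by
    have := hpos r ⟨hr.le, hra⟩
    positivity
  have hm1 : m * (1 - s) = (m * (p - 1) - 1) / (p - 1) := by
    rw [hs]; field_simp
  have hq : (t + 1) = p / (p - 1) := by rw [ht]; field_simp; ring
  have hqs : m * p / (m * (p - 1) - 1) = (t + 1) / (1 - s) := by
    have : 1 - s = (m * (p - 1) - 1) / (m * (p - 1)) := by rw [hs]; field_simp
    rw [this, hq]; field_simp
  have hle : r ^ (t + 1) ≤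
      M ^ (m * (1 - s)) * (m * p / (m * (p - 1) - 1)) * B⁻¹ := by
    have h4 : B * (r ^ (t + 1) / (t + 1)) ≤ M ^ (m * (1 - s)) / (1 - s) := by
      simp only [zero_div, mul_zero, add_zero] at h
      linarith
    rw [hqs, ← div_eq_mul_inv, le_div_iff₀ hB]
    calc r ^ (t + 1) * B = (B * (r ^ (t + 1) / (t + 1))) * (t + 1) := by field_simp
      _ ≤ (M ^ (m * (1 - s)) / (1 - s)) * (t + 1) := by gcongr
      _ = _ := by ring
  have hfin := Real.rpow_le_rpow (by positivity) hle (show 0 ≤ (p - 1) / p by positivity)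
  rw [← Real.rpow_mul hr.le, Real.mul_rpow (by positivity) (by positivity),
    Real.mul_rpow (by positivity) (by positivity), ← Real.rpow_mul hM.le, hBdef,
    ← Real.rpow_neg hβ.le, ← Real.rpow_mul hβ.le, hm1, hq, ht] at hfin
  have e1 : p / (p - 1) * ((p - 1) / p) = 1 := by field_simp
  have e2 : (m * (p - 1) - 1) / (p - 1) * ((p - 1) / p) = (m * (p - 1) - 1) / p := by field_simp
  have e3 : -(1 / (p - 1)) * ((p - 1) / p) = -(1 / p) := by field_simp
  rw [e1, e2, e3, Real.rpow_one] at hfin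
  exact hfin
end

section
/- Let N ≥ 1 be an integer, p > 1, β ≥ 0, α > βN real numbers, and a > 0. Let h : [0,a] → ℝ be continuous with h > 0 on (0,a) and h(a) = 0, and let P : (0,a] → ℝ be continuous at a and satisfy, for every r ∈ (0,a), P(r) = −β r h(r) − ((α − βN)/r^{N−1}) ∫_0^r s^{N−1} h(s) ds. Then P(a) = −((α − βN)/a^{N−1}) ∫_0^a s^{N−1} h(s) ds < 0. Consequently, if moreover g : ℝ → ℝ is differentiable at a with P(a) = |g'(a)|^{p−2} g'(a), then g'(a) = −(((α − βN)/a^{N−1}) ∫_0^a s^{N−1} h(s) ds)^{1/(p−1)} < 0, i.e. the profile crosses zero transversally at r = a. -/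
open Set

/-- Transversal crossing at the edge of the support: if `h` is continuous on `[0,a]`,
positive on `(0,a)` with `h(a) = 0`, `α > βN`, and `P` satisfies the first integral
identity on `(0,a)` and is continuous at `a` from within `(0,a]`, then
`P(a) = −((α − βN)/a^(N−1)) ∫₀^a s^(N−1) h(s) ds < 0`; consequently any `g`
differentiable at `a` with `|g'(a)|^(p−2) g'(a) = P(a)` has
`g'(a) = −(((α − βN)/a^(N−1)) ∫₀^a s^(N−1) h(s) ds)^(1/(p−1)) < 0`. -/
theorem stmt10 (N : ℕ) (hN : 1 ≤ N) (p β α a : ℝ) (hp : 1 < p) (hβ : 0 ≤ β)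
    (hα : β * N < α) (ha : 0 < a)
    (h : ℝ → ℝ) (hcont : ContinuousOn h (Icc 0 a))
    (hpos : ∀ s ∈ Ioo (0:ℝ) a, 0 < h s) (hha : h a = 0)
    (P : ℝ → ℝ) (hPcont : ContinuousWithinAt P (Ioc 0 a) a)
    (hP : ∀ r ∈ Ioo (0:ℝ) a,
      P r = -β * r * h r - ((α - β * N) / r ^ ((N:ℝ) - 1)) *
        ∫ s in (0:ℝ)..r, s ^ ((N:ℝ) - 1) * h s) :
    (P a = -(((α - β * N) / a ^ ((N:ℝ) - 1)) *
        ∫ s in (0:ℝ)..a, s ^ ((N:ℝ) - 1) * h s)) ∧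
    P a < 0 ∧
    ∀ g : ℝ → ℝ, DifferentiableAt ℝ g a →
      |deriv g a| ^ (p - 2) * deriv g a = P a →
      deriv g a = -((((α - β * N) / a ^ ((N:ℝ) - 1)) *
          ∫ s in (0:ℝ)..a, s ^ ((N:ℝ) - 1) * h s) ^ (1/(p-1))) ∧
      deriv g a < 0 := by
  have hN' : (0:ℝ) ≤ (N:ℝ) - 1 := by
    have : (1:ℝ) ≤ N := by exact_mod_cast hN
    linarith
  have hc : ContinuousOn (fun s : ℝ => s ^ ((N:ℝ) - 1) * h s) (Icc 0 a) :=
    (Real.continuous_rpow_const hN').continuousOn.mul hcont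
  have hc' : ContinuousOn (fun s : ℝ => s ^ ((N:ℝ) - 1) * h s) (uIcc 0 a) := by
    rwa [uIcc_of_le ha.le]
  have hint : IntervalIntegrable (fun s : ℝ => s ^ ((N:ℝ) - 1) * h s)
      MeasureTheory.volume 0 a := hc'.intervalIntegrable
  have hIcont : ContinuousOn (fun r : ℝ => ∫ s in (0:ℝ)..r, s ^ ((N:ℝ) - 1) * h s) (Icc 0 a) := by
    have := intervalIntegral.continuousOn_primitive_interval'
      hint (left_mem_uIcc)
    rwa [uIcc_of_le ha.le] at this
  have hIpos : 0 < ∫ s in (0:ℝ)..a, s ^ ((N:ℝ) - 1) * h s :=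
    intervalIntegral.intervalIntegral_pos_of_pos_on hint
      (fun s hs => mul_pos (Real.rpow_pos_of_pos hs.1 _) (hpos s hs)) ha
  have hapos : 0 < a ^ ((N:ℝ) - 1) := Real.rpow_pos_of_pos ha _
  have hamem : a ∈ Icc 0 a := ⟨ha.le, le_rfl⟩
  have hne : (nhdsWithin a (Ioo 0 a)).NeBot := by
    rw [← mem_closure_iff_nhdsWithin_neBot, closure_Ioo ha.ne]
    exact hamem
  have hR : ContinuousWithinAt (fun r : ℝ => -β * r * h r - ((α - β * N) / r ^ ((N:ℝ) - 1)) *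
        ∫ s in (0:ℝ)..r, s ^ ((N:ℝ) - 1) * h s) (Ioo 0 a) a := by
    have h1 := (hcont a hamem).mono (Ioo_subset_Icc_self)
    have h2 := (hIcont a hamem).mono (Ioo_subset_Icc_self)
    have h3 : ContinuousWithinAt (fun r : ℝ => r ^ ((N:ℝ) - 1)) (Ioo 0 a) a :=
      (Real.continuous_rpow_const hN').continuousWithinAt
    have h4 : ContinuousWithinAt (fun r : ℝ => -β * r) (Ioo 0 a) a := by fun_prop
    exact (h4.mul h1).sub ((continuousWithinAt_const.div h3 hapos.ne').mul h2)
  have hPI : Filter.Tendsto P (nhdsWithin a (Ioo 0 a)) (nhds (P a)) :=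
    hPcont.mono Ioo_subset_Ioc_self
  have hev := hPI.congr' (Filter.eventually_of_mem self_mem_nhdsWithin hP)
  have hPa := tendsto_nhds_unique hev hR
  simp only [hha, mul_zero, zero_sub] at hPa
  have hK : 0 < ((α - β * N) / a ^ ((N:ℝ) - 1)) * ∫ s in (0:ℝ)..a, s ^ ((N:ℝ) - 1) * h s :=
    mul_pos (div_pos (by linarith) hapos) hIpos
  refine ⟨hPa, by rw [hPa]; linarith, ?_⟩
  intro g _ hg
  rw [hPa] at hg
  generalize ((α - β * N) / a ^ ((N:ℝ) - 1)) * ∫ s in (0:ℝ)..a, s ^ ((N:ℝ) - 1) * h s = K at *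
  generalize deriv g a = d at *
  have hd : d < 0 := by
    by_contra hd
    have := mul_nonneg (Real.rpow_nonneg (abs_nonneg d) (p - 2)) (not_lt.mp hd)
    linarith
  refine ⟨?_, hd⟩
  have hd' : 0 < -d := by linarith
  have hKd : K = (-d) ^ (p - 1) := by
    rw [abs_of_neg hd] at hg
    have : (-d) ^ (p - 1) = (-d) ^ (p - 2) * (-d) := by
      rw [← Real.rpow_add_one hd'.ne']
      congr 1
      ring
    rw [this]
    linarith
  rw [hKd, ← Real.rpow_mul hd'.le, mul_one_div_cancel (by linarith), Real.rpow_one]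
  ring
end

section
/- Let p > 1 and m > 0 be real numbers with m(p−1) > 1, let β > 0 and a > 0, and let c > 0 be the constant determined by c^{m(p−1)−1} = β ((m(p−1)−1)/(mp))^{p−1}. Define the Barenblatt-type profile g : [0,a] → ℝ by g(r) = c^m (a^{p/(p−1)} − r^{p/(p−1)})^{m(p−1)/(m(p−1)−1)}. Then for every r ∈ (0,a), g is differentiable at r, g'(r) < 0, and |g'(r)|^{p−2} g'(r) = −β r g(r)^{1/m}. -/
open Set

/-- The Barenblatt-type profile
`g(r) = c^m (a^(p/(p−1)) − r^(p/(p−1)))^(m(p−1)/(m(p−1)−1))`, with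
`c^(m(p−1)−1) = β ((m(p−1)−1)/(mp))^(p−1)`, satisfies on `(0,a)`:
`g` is differentiable, `g' < 0` and `|g'|^(p−2) g' = −β r g^(1/m)`. -/
theorem stmt11 (p m β a c : ℝ) (hp : 1 < p) (hm : 0 < m) (hmp : 1 < m * (p - 1))
    (hβ : 0 < β) (ha : 0 < a) (hc : 0 < c)
    (hceq : c ^ (m*(p-1) - 1) = β * ((m*(p-1) - 1)/(m*p)) ^ (p-1))
    (g : ℝ → ℝ)
    (hg : g = fun r => c ^ m * (a ^ (p/(p-1)) - r ^ (p/(p-1))) ^ (m*(p-1)/(m*(p-1) - 1))) :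
    ∀ r ∈ Ioo (0:ℝ) a,
      DifferentiableAt ℝ g r ∧
      deriv g r < 0 ∧
      |deriv g r| ^ (p - 2) * deriv g r = -β * r * g r ^ (1/m) := by
  intro r hr
  obtain ⟨hr0, hra⟩ := hr
  have hp1 : 0 < p - 1 := by linarith
  have hp0 : 0 < p := by linarith
  obtain ⟨k, hk⟩ : ∃ k, k = m * (p - 1) - 1 := ⟨_, rfl⟩
  have hk0 : 0 < k := by linarith
  have hmk : m * (p - 1) = k + 1 := by linarith
  have hq0 : 0 < p / (p - 1) := by positivity
  obtain ⟨D, hD⟩ : ∃ D, D = a ^ (p/(p-1)) - r ^ (p/(p-1)) := ⟨_, rfl⟩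
  have hD0 : 0 < D := by
    rw [hD]
    have := Real.rpow_lt_rpow hr0.le hra hq0
    linarith
  rw [← hk] at hceq hg
  have hs1 : m * (p - 1) / k - 1 = 1 / k := by
    rw [hmk]; field_simp; ring
  have hq1 : p / (p - 1) - 1 = 1 / (p - 1) := by
    field_simp; ring
  have hsq : (m * (p - 1) / k) * (p / (p - 1)) = m * p / k := by
    field_simp
  obtain ⟨L, hL⟩ : ∃ L, L = c ^ m * (m * p / k) * D ^ (1 / k) * r ^ (1 / (p - 1)) := ⟨_, rfl⟩
  have hL0 : 0 < L := by rw [hL]; positivity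
  have hder : HasDerivAt g (-L) r := by
    have h1 : HasDerivAt (fun x : ℝ => x ^ (p/(p-1))) ((p/(p-1)) * r ^ (p/(p-1) - 1)) r :=
      Real.hasDerivAt_rpow_const (Or.inl hr0.ne')
    have h2 := (((h1.const_sub (a ^ (p/(p-1)))).rpow_const (p := m * (p - 1) / k)
      (Or.inl (by rw [← hD]; exact hD0.ne'))).const_mul (c ^ m))
    rw [hg]
    refine h2.congr_deriv ?_
    rw [← hD, hs1, hq1, hL, ← hsq]
    ring
  refine ⟨hder.differentiableAt, ?_, ?_⟩
  · rw [hder.deriv]; linarith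
  · rw [hder.deriv, abs_neg, abs_of_pos hL0]
    have e1 : L ^ (p - 2) * L = L ^ (p - 1) := by
      rw [← Real.rpow_add_one hL0.ne']; congr 1; ring
    have hgr : g r ^ (1 / m) = c * D ^ ((p - 1) / k) := by
      rw [hg]
      simp only [← hD]
      rw [Real.mul_rpow (by positivity) (by positivity), ← Real.rpow_mul hc.le,
        ← Real.rpow_mul hD0.le]
      have h1 : m * (1 / m) = 1 := by field_simp
      have h2 : m * (p - 1) / k * (1 / m) = (p - 1) / k := by field_simp
      rw [h1, h2, Real.rpow_one]
    have e2 : L ^ (p - 1) = β * r * (c * D ^ ((p - 1) / k)) := by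
      rw [hL, Real.mul_rpow (by positivity) (by positivity),
        Real.mul_rpow (by positivity) (by positivity),
        Real.mul_rpow (by positivity) (by positivity),
        ← Real.rpow_mul hc.le, ← Real.rpow_mul hD0.le, ← Real.rpow_mul hr0.le, hmk,
        Real.rpow_add_one hc.ne', hceq]
      have h1 : 1 / (p - 1) * (p - 1) = 1 := by field_simp
      have h2 : 1 / k * (p - 1) = (p - 1) / k := by ring
      have h3 : (k / (m * p)) ^ (p - 1) * (m * p / k) ^ (p - 1) = 1 := by
        rw [← Real.mul_rpow (by positivity) (by positivity)]
        have : k / (m * p) * (m * p / k) = 1 := by field_simp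
        rw [this, Real.one_rpow]
      rw [h1, h2, Real.rpow_one]
      linear_combination (β * c * D ^ ((p - 1) / k) * r) * h3
    rw [hgr]
    linear_combination -e1 - e2
end

section
/- Let N ≥ 1 be an integer, p > 1 a real number, and x ∈ ℝ^N. Let w : ℝ^N → ℝ be twice continuously differentiable on a neighborhood of x with ∇w(x) ≠ 0, and let f : ℝ → ℝ be twice continuously differentiable on a neighborhood of w(x) with f'(w(x)) > 0. Then Δ_p w(x) and Δ_p(f ∘ w)(x) are both defined, and Δ_p(f ∘ w)(x) = f'(w(x))^{p−1} Δ_p w(x) + (p−1) f'(w(x))^{p−2} f''(w(x)) ‖∇w(x)‖^p. -/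
/-- The pointwise `p`-Laplacian `Δ_p w(x) = div(‖∇w‖^(p−2) ∇w)(x)`, defined as the
trace of the Fréchet derivative at `x` of the vector field `y ↦ ‖∇w(y)‖^(p−2) ∇w(y)`. -/
noncomputable def pLap (N : ℕ) (p : ℝ) (w : EuclideanSpace ℝ (Fin N) → ℝ)
    (x : EuclideanSpace ℝ (Fin N)) : ℝ :=
  LinearMap.trace ℝ (EuclideanSpace ℝ (Fin N))
    ((fderiv ℝ (fun y => ‖gradient w y‖ ^ (p - 2) • gradient w y) x).toLinearMap)

/-- Chain rule for the `p`-Laplacian: if `w` is `C²` near `x` with `∇w(x) ≠ 0` and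
`f` is `C²` near `w(x)` with `f'(w(x)) > 0`, then `Δ_p w(x)` and `Δ_p (f ∘ w)(x)` are
both defined and
`Δ_p(f∘w)(x) = f'(w(x))^(p−1) Δ_p w(x) + (p−1) f'(w(x))^(p−2) f''(w(x)) ‖∇w(x)‖^p`. -/
theorem stmt15 (N : ℕ) (hN : 1 ≤ N) (p : ℝ) (hp : 1 < p)
    (x : EuclideanSpace ℝ (Fin N)) (w : EuclideanSpace ℝ (Fin N) → ℝ) (f : ℝ → ℝ)
    (hw : ∃ s ∈ nhds x, ContDiffOn ℝ 2 w s)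
    (hf : ∃ t ∈ nhds (w x), ContDiffOn ℝ 2 f t)
    (hgrad : gradient w x ≠ 0)
    (hf' : 0 < deriv f (w x)) :
    DifferentiableAt ℝ (fun y => ‖gradient w y‖ ^ (p - 2) • gradient w y) x ∧
    DifferentiableAt ℝ
      (fun y => ‖gradient (f ∘ w) y‖ ^ (p - 2) • gradient (f ∘ w) y) x ∧
    pLap N p (f ∘ w) x =
      deriv f (w x) ^ (p - 1) * pLap N p w x +
        (p - 1) * deriv f (w x) ^ (p - 2) * deriv (deriv f) (w x) *
          ‖gradient w x‖ ^ p := by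
  obtain ⟨s, hs, hws⟩ := hw
  obtain ⟨t, ht, hft⟩ := hf
  have hwx : ContDiffAt ℝ 2 w x := hws.contDiffAt hs
  have hfx : ContDiffAt ℝ 2 f (w x) := hft.contDiffAt ht
  -- gradient of w is differentiable at x
  have hDw : DifferentiableAt ℝ (fderiv ℝ w) x :=
    (hwx.fderiv_right (m := 1) (by norm_num)).differentiableAt (by norm_num)
  have hgw : DifferentiableAt ℝ (gradient w) x :=
    ((InnerProductSpace.toDual ℝ (EuclideanSpace ℝ (Fin N))).symm.toContinuousLinearEquiv.toContinuousLinearMap.differentiableAt).comp x hDw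
  have hnorm : ‖gradient w x‖ ≠ 0 := norm_ne_zero_iff.mpr hgrad
  have hG : DifferentiableAt ℝ (fun y => ‖gradient w y‖ ^ (p - 2) • gradient w y) x :=
    ((hgw.norm ℝ hgrad).rpow_const (Or.inl hnorm)).smul hgw
  have hdf : DifferentiableAt ℝ (deriv f) (w x) := by
    have h1 : DifferentiableAt ℝ (fderiv ℝ f) (w x) :=
      (hfx.fderiv_right (m := 1) (by norm_num)).differentiableAt (by norm_num)
    exact h1.clm_apply (differentiableAt_const (1 : ℝ))
  have hwd : DifferentiableAt ℝ w x := hwx.differentiableAt (by norm_num)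
  have hc : HasFDerivAt (fun y => deriv f (w y) ^ (p - 1))
      (((p - 1) * deriv f (w x) ^ (p - 2) * deriv (deriv f) (w x)) • fderiv ℝ w x) x := by
    have h1 : HasDerivAt (fun u => deriv f u ^ (p - 1))
        (deriv (deriv f) (w x) * (p - 1) * deriv f (w x) ^ (p - 1 - 1)) (w x) :=
      hdf.hasDerivAt.rpow_const (Or.inl hf'.ne')
    have h2 := h1.comp_hasFDerivAt x hwd.hasFDerivAt
    have e : (p - 1) * deriv f (w x) ^ (p - 2) * deriv (deriv f) (w x)
        = deriv (deriv f) (w x) * (p - 1) * deriv f (w x) ^ (p - 1 - 1) := by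
      rw [show p - 1 - 1 = p - 2 by ring]; ring
    rw [e]; exact h2
  have hev : (fun y => ‖gradient (f ∘ w) y‖ ^ (p - 2) • gradient (f ∘ w) y) =ᶠ[nhds x]
      (fun y => deriv f (w y) ^ (p - 1) • (‖gradient w y‖ ^ (p - 2) • gradient w y)) := by
    have a1 : ∀ᶠ y in nhds x, ContDiffAt ℝ 2 w y := hwx.eventually (by simp)
    have a2 : ∀ᶠ y in nhds x, ContDiffAt ℝ 2 f (w y) :=
      hwd.continuousAt.eventually (hfx.eventually (by simp))
    have a3 : ∀ᶠ y in nhds x, 0 < deriv f (w y) :=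
      hwd.continuousAt.eventually (hdf.continuousAt.eventually (lt_mem_nhds hf'))
    filter_upwards [a1, a2, a3] with y h1 h2 h3
    have hg : gradient (f ∘ w) y = deriv f (w y) • gradient w y := by
      have h4 : HasFDerivAt (f ∘ w) (deriv f (w y) • fderiv ℝ w y) y :=
        (h2.differentiableAt (by norm_num)).hasDerivAt.comp_hasFDerivAt y
          (h1.differentiableAt (by norm_num)).hasFDerivAt
      unfold gradient
      rw [h4.fderiv]
      simp
    rw [hg, norm_smul, Real.norm_of_nonneg h3.le,
      Real.mul_rpow h3.le (norm_nonneg _), smul_smul, smul_smul]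
    congr 1
    have : deriv f (w y) ^ (p - 1) = deriv f (w y) ^ (p - 2) * deriv f (w y) := by
      rw [show p - 1 = (p - 2) + 1 by ring, Real.rpow_add_one h3.ne']
    rw [this]; ring
  have hH := (hc.smul hG.hasFDerivAt).congr_of_eventuallyEq hev
  refine ⟨hG, hH.differentiableAt, ?_⟩
  have hin : fderiv ℝ w x (gradient w x) = ‖gradient w x‖ ^ 2 := by
    rw [← real_inner_self_eq_norm_sq]
    exact (InnerProductSpace.toDual_symm_apply
      (𝕜 := ℝ) (x := gradient w x) (y := fderiv ℝ w x)).symm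
  have hpow : ‖gradient w x‖ ^ p = ‖gradient w x‖ ^ (p - 2) * ‖gradient w x‖ ^ 2 := by
    rw [← Real.rpow_add_natCast hnorm]; norm_num
  unfold pLap
  rw [hH.fderiv]
  have htr : ∀ (c : EuclideanSpace ℝ (Fin N) →L[ℝ] ℝ) (v : EuclideanSpace ℝ (Fin N)),
      LinearMap.trace ℝ (EuclideanSpace ℝ (Fin N)) (c.smulRight v).toLinearMap = c v := by
    intro c v
    exact LinearMap.trace_smulRight c.toLinearMap v
  rw [ContinuousLinearMap.toLinearMap_add, map_add, htr, ContinuousLinearMap.toLinearMap_smul,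
    map_smul, hpow]
  simp only [ContinuousLinearMap.smul_apply, map_smul, smul_eq_mul, hin]
  ring
end
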